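/- arXiv:2601.21243 — 4 statements merged into one kernel-verified Lean document; each statement's English description precedes it below -/
import Mathlib

section
/- Let f : 2^{[n]} × ℝ^m → ℝ be submodular with respect to its first variable and concave with respect to its second variable, let f^L(x,y) = ∫₀¹ f(S_τ(x), y) dτ be its Lovász extension in the first variable, and let Y ⊂ ℝ^m be a nonempty convex compact set. Then min_{x ∈ [0,1]^n} max_{y ∈ Y} f^L(x,y) = max_{y ∈ Y} min_{S ⊆ [n]} f(S,y); in particular, a saddle point of f^L over [0,1]^n × Y exists, and the max-min value of f equals the min-max value of f^L. -/
open MeasureTheory Finset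

/-- The Lovász extension of `f : 2^{[n]} × ℝ^m → ℝ` in its first variable:
`f^L(x,y) = ∫₀¹ f(S_τ(x), y) dτ` where `S_τ(x) = {i : x_i > τ}`. -/
noncomputable def lovasz {n : ℕ} {α : Type*} (f : Finset (Fin n) → α → ℝ)
    (x : Fin n → ℝ) (y : α) : ℝ :=
  ∫ τ in (0:ℝ)..1, f (Finset.univ.filter fun i => τ < x i) y

lemma lov_greedy {n : ℕ} (g : Finset (Fin n) → ℝ)
    (hsub : ∀ S T : Finset (Fin n), g (S ∩ T) + g (S ∪ T) ≤ g S + g T)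
    (x : Fin n → ℝ) :
    ∃ w : Fin n → ℝ, (∀ S : Finset (Fin n), g ∅ + ∑ i ∈ S, w i ≤ g S) ∧
      ∀ τ : ℝ, g (Finset.univ.filter fun i => τ < x i)
        = g ∅ + ∑ i ∈ Finset.univ.filter (fun i => τ < x i), w i := by
  classical
  let k : Fin n → ℝ ×ₗ Fin n := fun i => toLex (-x i, i)
  have hk : Function.Injective k := by
    intro a b h
    have := congrArg (fun p => (ofLex p).2) h
    simpa [k] using this
  let P : Fin n → Finset (Fin n) := fun i => Finset.univ.filter fun j => k j < k i
  let w : Fin n → ℝ := fun i => g (insert i (P i)) - g (P i)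
  refine ⟨w, ?_, ?_⟩
  · intro S
    induction S using Finset.induction_on_max_value k with
    | empty => simp
    | insert a s ha hle ih =>
      have hs : s ⊆ P a := by
        intro j hj
        simp only [P, Finset.mem_filter, Finset.mem_univ, true_and]
        refine lt_of_le_of_ne (hle j hj) fun h => ha ?_
        rw [← hk h]; exact hj
      have haP : a ∉ P a := by simp [P]
      have h1 : insert a s ∩ P a = s := by
        rw [Finset.insert_inter_of_notMem haP, Finset.inter_eq_left.2 hs]
      have h2 : insert a s ∪ P a = insert a (P a) := by
        rw [Finset.insert_union, Finset.union_eq_right.2 hs]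
      have h3 := hsub (insert a s) (P a)
      rw [h1, h2] at h3
      rw [Finset.sum_insert ha]
      simp only [w] at ih ⊢
      linarith
  · have key : ∀ S : Finset (Fin n), (∀ i ∈ S, ∀ j, k j < k i → j ∈ S) →
        g S = g ∅ + ∑ i ∈ S, w i := by
      intro S
      induction S using Finset.induction_on_max_value k with
      | empty => simp
      | insert a s ha hle ih =>
        intro hd
        have hs : P a = s := by
          ext j
          simp only [P, Finset.mem_filter, Finset.mem_univ, true_and]
          constructor
          · intro hj
            have := hd a (Finset.mem_insert_self _ _) j hj
            rcases Finset.mem_insert.1 this with h | h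
            · subst h; exact absurd hj (lt_irrefl _)
            · exact h
          · intro hj
            refine lt_of_le_of_ne (hle j hj) fun h => ha ?_
            rw [← hk h]; exact hj
        have ih' := ih (by
          intro i hi j hj
          rw [← hs]
          simp only [P, Finset.mem_filter, Finset.mem_univ, true_and]
          exact lt_of_lt_of_le hj (hle i hi))
        rw [Finset.sum_insert ha]
        simp only [w, hs] at ih' ⊢
        linarith
    intro τ
    apply key
    intro i hi j hj
    simp only [Finset.mem_filter, Finset.mem_univ, true_and] at hi ⊢
    simp only [k, Prod.Lex.toLex_lt_toLex] at hj
    rcases hj with h | h <;> linarith [h]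

lemma lov_integrable (c w : ℝ) :
    IntervalIntegrable (fun τ : ℝ => if τ < c then w else 0) volume 0 1 := by
  rw [intervalIntegrable_iff]
  have : (fun τ : ℝ => if τ < c then w else 0) = (Set.Iio c).indicator (fun _ => w) := by
    ext τ; simp [Set.indicator]
  rw [this]
  exact (integrableOn_const (by simp)).indicator measurableSet_Iio

lemma lov_int (c w : ℝ) (h0 : 0 ≤ c) (h1 : c ≤ 1) :
    ∫ τ in (0:ℝ)..1, (if τ < c then w else 0) = w * c := by
  have : (fun τ : ℝ => if τ < c then w else 0) = (Set.Iio c).indicator (fun _ => w) := by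
    ext τ; simp [Set.indicator]
  rw [this, intervalIntegral.integral_of_le zero_le_one,
    setIntegral_indicator measurableSet_Iio]
  have h : Set.Ioc (0:ℝ) 1 ∩ Set.Iio c = Set.Ioo 0 c := by
    ext t; simp only [Set.mem_inter_iff, Set.mem_Ioc, Set.mem_Iio, Set.mem_Ioo]
    constructor
    · rintro ⟨⟨a, _⟩, b⟩; exact ⟨a, b⟩
    · rintro ⟨a, b⟩; exact ⟨⟨a, by linarith⟩, b⟩
  rw [h]
  simp [h0, mul_comm]

lemma lov_main {n : ℕ} {α : Type*} (f : Finset (Fin n) → α → ℝ) (y : α)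
    (hsub : ∀ S T : Finset (Fin n), f (S ∩ T) y + f (S ∪ T) y ≤ f S y + f T y)
    (x : Fin n → ℝ) (hx : x ∈ Set.Icc (0 : Fin n → ℝ) 1) :
    (∃ w : Fin n → ℝ, (∀ S : Finset (Fin n), f ∅ y + ∑ i ∈ S, w i ≤ f S y) ∧
      lovasz f x y = f ∅ y + ∑ i, w i * x i) ∧
    (∀ a, (∀ S, a ≤ f S y) → a ≤ lovasz f x y) ∧
    (∀ a, (∀ S, f S y ≤ a) → lovasz f x y ≤ a) := by
  obtain ⟨w, hw1, hw2⟩ := lov_greedy (fun S => f S y) hsub x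
  have he : (fun τ : ℝ => f (Finset.univ.filter fun i => τ < x i) y)
      = fun τ => f ∅ y + ∑ i, if τ < x i then w i else 0 := by
    ext τ
    rw [hw2 τ, Finset.sum_filter]
  have hI : IntervalIntegrable (fun τ : ℝ => ∑ i, if τ < x i then w i else 0) volume 0 1 := by
    have := IntervalIntegrable.sum (μ := volume) (a := 0) (b := 1) (Finset.univ)
      (f := fun i (τ : ℝ) => if τ < x i then w i else 0) (fun i _ => lov_integrable (x i) (w i))
    have he2 : (fun τ : ℝ => ∑ i, if τ < x i then w i else 0)
        = ∑ i, fun (τ : ℝ) => if τ < x i then w i else 0 := by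
      ext τ; simp only [Finset.sum_apply]
    rw [he2]
    exact this
  have hI2 : IntervalIntegrable
      (fun τ : ℝ => f (Finset.univ.filter fun i => τ < x i) y) volume 0 1 := by
    rw [he]
    exact intervalIntegrable_const.add hI
  refine ⟨⟨w, hw1, ?_⟩, ?_, ?_⟩
  · unfold lovasz
    rw [he, intervalIntegral.integral_add intervalIntegrable_const hI,
      intervalIntegral.integral_finsetSum (fun i _ => lov_integrable (x i) (w i))]
    rw [Finset.sum_congr rfl (fun i _ => lov_int (x i) (w i) (hx.1 i) (hx.2 i))]
    simp
  · intro a ha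
    have := intervalIntegral.integral_mono_on (μ := volume) (zero_le_one' ℝ)
      (intervalIntegrable_const (c := a)) hI2 (fun τ _ => ha _)
    simpa [lovasz] using this
  · intro a ha
    have := intervalIntegral.integral_mono_on (μ := volume) (zero_le_one' ℝ)
      hI2 (intervalIntegrable_const (c := a)) (fun τ _ => ha _)
    simpa [lovasz] using this

lemma lov_sep {ι E : Type*} [Fintype ι] [Nonempty ι] [AddCommGroup E] [Module ℝ E]
    (Y : Set E) (hY : Y.Nonempty) (hYc : Convex ℝ Y) (f : ι → E → ℝ)
    (hf : ∀ i, ConcaveOn ℝ Set.univ (f i)) (v : ℝ)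
    (hv : ∀ y ∈ Y, ∃ i, f i y ≤ v) :
    ∃ l : ι → ℝ, (∀ i, 0 ≤ l i) ∧ ∑ i, l i = 1 ∧ ∀ y ∈ Y, ∑ i, l i * f i y ≤ v := by
  classical
  let A : Set (ι → ℝ) := {z | ∃ y ∈ Y, ∀ i, z i ≤ f i y - v}
  let B : Set (ι → ℝ) := Set.univ.pi fun _ => Set.Ioi 0
  have hB : Convex ℝ B := convex_pi fun _ _ => convex_Ioi 0
  have hBo : IsOpen B := isOpen_set_pi Set.finite_univ fun _ _ => isOpen_Ioi
  have hmB : ∀ z, z ∈ B ↔ ∀ i, 0 < z i := by intro z; simp [B]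
  have hA : Convex ℝ A := by
    rintro z ⟨y, hy, h⟩ z' ⟨y', hy', h'⟩ a b ha hb hab
    refine ⟨a • y + b • y', hYc hy hy' ha hb hab, fun i => ?_⟩
    have h1 := (hf i).2 (Set.mem_univ y) (Set.mem_univ y') ha hb hab
    simp only [smul_eq_mul, Pi.add_apply, Pi.smul_apply] at h1 ⊢
    have h2 := mul_le_mul_of_nonneg_left (h i) ha
    have h3 := mul_le_mul_of_nonneg_left (h' i) hb
    have h4 : v = a * v + b * v := by rw [← add_mul, hab, one_mul]
    linarith
  have hd : Disjoint B A := by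
    rw [Set.disjoint_left]
    rintro z hz ⟨y, hy, h⟩
    obtain ⟨i, hi⟩ := hv y hy
    have := (hmB z).1 hz i
    linarith [h i]
  obtain ⟨φ, u, hφB, hφA⟩ := geometric_hahn_banach_open hB hBo hA hd
  have hφ : ∀ z, φ z = ∑ i, z i * φ (Pi.single i 1) := by
    intro z
    conv_lhs => rw [pi_eq_sum_univ' z]
    simp [map_sum]
    try rfl
  have hneg : ∀ z ∈ B, φ z ≤ 0 := by
    intro z hz
    by_contra! h
    have ht : 0 < (|u| + 1) / φ z := by positivity
    have := hφB (((|u| + 1) / φ z) • z)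
      ((hmB _).2 fun i => by
        simpa using mul_pos ht ((hmB z).1 hz i))
    rw [map_smul, smul_eq_mul, div_mul_cancel₀ _ h.ne'] at this
    linarith [le_abs_self u]
  have hone : (fun _ => (1:ℝ)) ∈ B := (hmB _).2 fun _ => one_pos
  have hu : 0 ≤ u := by
    by_contra! h
    set p := φ (fun _ => (1:ℝ)) with hp
    have hp0 : p ≤ 0 := hneg _ hone
    have ht : 0 < (-u) / (1 - p) := by apply div_pos <;> linarith
    have := hφB (((-u) / (1 - p)) • (fun _ => (1:ℝ)))
      ((hmB _).2 fun i => by simpa using ht)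
    rw [map_smul, smul_eq_mul, ← hp] at this
    rw [div_mul_eq_mul_div, div_lt_iff₀ (by linarith)] at this
    nlinarith
  have hl : ∀ i, φ (Pi.single i 1) ≤ 0 := by
    intro i
    by_contra! h
    set p := φ (fun _ => (1:ℝ)) with hp
    have hp0 : p ≤ 0 := hneg _ hone
    set q := φ (Pi.single i 1) with hq
    have hmem : ((1 - p) • (Pi.single i 1 : ι → ℝ) + (q / 2) • (fun _ => (1:ℝ))) ∈ B := by
      refine (hmB _).2 fun j => ?_
      have : (0:ℝ) ≤ (Pi.single i 1 : ι → ℝ) j := by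
        by_cases hj : j = i
        · subst hj; simp
        · simp [hj]
      have := mul_nonneg (by linarith : 0 ≤ 1 - p) this
      simp only [Pi.add_apply, Pi.smul_apply, smul_eq_mul, mul_one]
      linarith
    have := hneg _ hmem
    rw [map_add, map_smul, map_smul, smul_eq_mul, smul_eq_mul, ← hp, ← hq] at this
    nlinarith
  obtain ⟨y0, hy0⟩ := hY
  set L := ∑ i, -φ (Pi.single i 1) with hL
  have hL0 : 0 ≤ L := Finset.sum_nonneg fun i _ => by linarith [hl i]
  have hLpos : 0 < L := by
    refine lt_of_le_of_ne hL0 fun h => ?_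
    have hz := (Finset.sum_eq_zero_iff_of_nonneg (fun i _ => by linarith [hl i])).1 h.symm
    have hz' : ∀ z, φ z = 0 := by
      intro z
      rw [hφ]
      refine Finset.sum_eq_zero fun i hi => ?_
      have := hz i hi
      rw [neg_eq_zero.1 this, mul_zero]
    have h1 := hφB _ hone
    have h2 := hφA (fun i => f i y0 - v) ⟨y0, hy0, fun i => le_rfl⟩
    rw [hz'] at h1 h2
    linarith
  refine ⟨fun i => -φ (Pi.single i 1) / L, fun i => div_nonneg (by linarith [hl i]) hL0, ?_, ?_⟩
  · rw [← Finset.sum_div, ← hL, div_self hLpos.ne']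
  · intro y hy
    have h2 := hφA (fun i => f i y - v) ⟨y, hy, fun i => le_rfl⟩
    rw [hφ] at h2
    have h3 : ∑ i, (f i y - v) * φ (Pi.single i 1)
        = v * L - ∑ i, -φ (Pi.single i 1) * f i y := by
      rw [hL, Finset.mul_sum, ← Finset.sum_sub_distrib]
      exact Finset.sum_congr rfl fun i _ => by ring
    have h4 : ∑ i, -φ (Pi.single i 1) / L * f i y = (∑ i, -φ (Pi.single i 1) * f i y) / L := by
      rw [Finset.sum_div]
      exact Finset.sum_congr rfl fun i _ => by ring
    rw [h4, div_le_iff₀ hLpos]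
    linarith

/-- If `f : 2^{[n]} × ℝ^m → ℝ` is submodular in its first variable and concave in
its second variable, `f^L` is its Lovász extension in the first variable, and
`Y ⊂ ℝ^m` is nonempty, convex and compact, then a saddle point of `f^L` over
`[0,1]^n × Y` exists, and
`min_{x∈[0,1]^n} max_{y∈Y} f^L(x,y) = max_{y∈Y} min_{S⊆[n]} f(S,y)`. -/
theorem lovasz_minmax_eq_maxmin (n m : ℕ)
    (f : Finset (Fin n) → EuclideanSpace ℝ (Fin m) → ℝ)
    (hsub : ∀ y, ∀ S T : Finset (Fin n), f (S ∩ T) y + f (S ∪ T) y ≤ f S y + f T y)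
    (hconc : ∀ S : Finset (Fin n), ConcaveOn ℝ Set.univ (f S))
    (Y : Set (EuclideanSpace ℝ (Fin m))) (hY : Y.Nonempty)
    (hYconv : Convex ℝ Y) (hYc : IsCompact Y) :
    (∃ xs ∈ Set.Icc (0 : Fin n → ℝ) 1, ∃ ys ∈ Y,
        ∀ x ∈ Set.Icc (0 : Fin n → ℝ) 1, ∀ y ∈ Y,
          lovasz f xs y ≤ lovasz f xs ys ∧ lovasz f xs ys ≤ lovasz f x ys)
    ∧ sInf ((fun x => sSup ((fun y => lovasz f x y) '' Y)) '' Set.Icc (0 : Fin n → ℝ) 1)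
        = sSup ((fun y => (Finset.univ : Finset (Finset (Fin n))).inf'
            Finset.univ_nonempty (fun S => f S y)) '' Y) := by
  classical
  have hcont : ∀ S, ContinuousOn (f S) Y := fun S =>
    ((hconc S).continuousOn isOpen_univ).mono (Set.subset_univ _)
  have hFc : ContinuousOn (fun y => (Finset.univ : Finset (Finset (Fin n))).inf'
            Finset.univ_nonempty (fun S => f S y)) Y :=
    ContinuousOn.finset_inf'_apply Finset.univ_nonempty fun S _ => hcont S
  obtain ⟨ys, hys, hmax⟩ := hYc.exists_isMaxOn hY hFc
  set v := (Finset.univ : Finset (Finset (Fin n))).inf'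
            Finset.univ_nonempty (fun S => f S ys) with hv
  have hvle : ∀ S, v ≤ f S ys := fun S => Finset.inf'_le _ (Finset.mem_univ S)
  obtain ⟨l, hl0, hl1, hl⟩ := lov_sep Y hY hYconv f hconc v (by
    intro y hy
    obtain ⟨S, _, hS⟩ := Finset.exists_mem_eq_inf' (Finset.univ_nonempty
      (α := Finset (Fin n))) (fun S => f S y)
    refine ⟨S, ?_⟩
    rw [← hS]
    exact hmax hy)
  set xs : Fin n → ℝ := fun i => ∑ S, if i ∈ S then l S else 0 with hxs
  have hxm : xs ∈ Set.Icc (0 : Fin n → ℝ) 1 := by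
    constructor
    · intro i
      exact Finset.sum_nonneg fun S _ => by split_ifs; exacts [hl0 S, le_rfl]
    · intro i
      simp only [Pi.one_apply, ← hl1]
      exact Finset.sum_le_sum fun S _ => by split_ifs; exacts [le_rfl, hl0 S]
  have hup : ∀ y ∈ Y, lovasz f xs y ≤ v := by
    intro y hy
    obtain ⟨⟨w, hw, he⟩, _⟩ := lov_main f y (hsub y) xs hxm
    refine le_trans ?_ (hl y hy)
    have h1 : ∑ i, w i * xs i = ∑ S, l S * ∑ i ∈ S, w i := by
      simp only [hxs, Finset.mul_sum]
      rw [Finset.sum_comm]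
      refine Finset.sum_congr rfl fun S _ => ?_
      rw [← Finset.sum_filter_add_sum_filter_not Finset.univ (fun i => i ∈ S)]
      rw [Finset.sum_eq_zero (s := Finset.univ.filter fun i => i ∉ S)]
      · rw [add_zero, Finset.filter_univ_mem]
        exact Finset.sum_congr rfl fun i hi => by rw [if_pos hi, mul_comm]
      · intro i hi
        rw [if_neg (Finset.mem_filter.1 hi).2, mul_zero]
    have h2 : f ∅ y = ∑ S, l S * f ∅ y := by rw [← Finset.sum_mul, hl1, one_mul]
    rw [he, h1, h2, ← Finset.sum_add_distrib]
    refine Finset.sum_le_sum fun S _ => ?_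
    rw [← mul_add]
    exact mul_le_mul_of_nonneg_left (hw S) (hl0 S)
  have hlow : ∀ x ∈ Set.Icc (0 : Fin n → ℝ) 1, v ≤ lovasz f x ys := fun x hx =>
    (lov_main f ys (hsub ys) x hx).2.1 v hvle
  have heq : lovasz f xs ys = v := le_antisymm (hup ys hys) (hlow xs hxm)
  refine ⟨⟨xs, hxm, ys, hys, fun x hx y hy => ⟨heq ▸ hup y hy, heq ▸ hlow x hx⟩⟩, ?_⟩
  have hR : sSup ((fun y => (Finset.univ : Finset (Finset (Fin n))).inf'
            Finset.univ_nonempty (fun S => f S y)) '' Y) = v := by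
    apply IsGreatest.csSup_eq
    refine ⟨⟨ys, hys, rfl⟩, ?_⟩
    rintro _ ⟨y, hy, rfl⟩
    exact hmax hy
  rw [hR]
  have hbdd : ∀ x ∈ Set.Icc (0 : Fin n → ℝ) 1,
      BddAbove ((fun y => lovasz f x y) '' Y) := by
    intro x hx
    have : ∀ S, ∃ C, ∀ y ∈ Y, f S y ≤ C := fun S => by
      obtain ⟨C, hC⟩ := hYc.bddAbove_image (hcont S)
      exact ⟨C, fun y hy => hC ⟨y, hy, rfl⟩⟩
    choose C hC using this
    refine ⟨∑ S, |C S|, ?_⟩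
    rintro _ ⟨y, hy, rfl⟩
    refine (lov_main f y (hsub y) x hx).2.2 _ fun S => ?_
    exact (hC S y hy).trans ((le_abs_self _).trans
      (Finset.single_le_sum (f := fun S => |C S|) (fun S _ => abs_nonneg _) (Finset.mem_univ S)))
  apply IsLeast.csInf_eq
  refine ⟨⟨xs, hxm, ?_⟩, ?_⟩
  · apply IsGreatest.csSup_eq
    refine ⟨⟨ys, hys, heq⟩, ?_⟩
    rintro _ ⟨y, hy, rfl⟩
    exact hup y hy
  · rintro _ ⟨x, hx, rfl⟩
    exact (hlow x hx).trans (le_csSup (hbdd x hx) ⟨ys, hys, rfl⟩)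
end

section
/- Let f : 2^{[n]} × ℝ^m → ℝ be submodular with respect to its first variable and concave with respect to its second variable, let f^L(x,y) = ∫₀¹ f(S_τ(x), y) dτ be its Lovász extension in the first variable, and let Y ⊂ ℝ^m be a nonempty convex compact set. If min_{x ∈ [0,1]^n} max_{y ∈ Y} f^L(x,y) = min_{x ∈ {0,1}^n} max_{y ∈ Y} f^L(x,y), then max_{y ∈ Y} min_{S ⊆ [n]} f(S,y) = min_{S ⊆ [n]} max_{y ∈ Y} f(S,y), so a saddle point of f over 2^{[n]} × Y exists, and the common value equals min_{x ∈ [0,1]^n} max_{y ∈ Y} f^L(x,y). -/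
open MeasureTheory Finset

/-- The set of vertices `{0,1}^n` of the hypercube `[0,1]^n`. -/
def vertices (n : ℕ) : Set (Fin n → ℝ) := {x | ∀ i, x i = 0 ∨ x i = 1}

lemma greedy_aux {n : ℕ} (g : Finset (Fin n) → ℝ)
    (hsub : ∀ S T : Finset (Fin n), g (S ∩ T) + g (S ∪ T) ≤ g S + g T)
    (x : Fin n → ℝ) :
    ∃ w : Fin n → ℝ, (∀ S : Finset (Fin n), g ∅ + ∑ i ∈ S, w i ≤ g S) ∧
      ∀ τ : ℝ, g (Finset.univ.filter fun i => τ < x i)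
        = g ∅ + ∑ i ∈ (Finset.univ.filter fun i => τ < x i), w i := by
  classical
  obtain ⟨r, hr⟩ : ∃ r : Equiv.Perm (Fin n), ∀ i j, r i ≤ r j → x j ≤ x i := by
    refine ⟨(Tuple.sort (fun i => - x i)).symm, fun i j h => ?_⟩
    have := Tuple.monotone_sort (fun i => - x i) h
    simpa using this
  let P : ℕ → Finset (Fin n) := fun k => Finset.univ.filter fun i => (r i : ℕ) < k
  have hP0 : P 0 = ∅ := by ext i; simp [P]
  have hPn : P n = Finset.univ := by ext i; simp [P]
  have hPs : ∀ j : Fin n, P (r j + 1) = insert j (P (r j)) := by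
    intro j
    ext i
    simp only [P, Finset.mem_filter, Finset.mem_univ, true_and, Finset.mem_insert]
    rw [Nat.lt_succ_iff, le_iff_lt_or_eq, or_comm, ← Fin.ext_iff, r.injective.eq_iff]
  have hjP : ∀ j : Fin n, j ∉ P (r j) := by intro j; simp [P]
  let w : Fin n → ℝ := fun j => g (P (r j + 1)) - g (P (r j))
  have hex : ∀ k, k < n → ∃ j : Fin n, (r j : ℕ) = k := by
    intro k hk
    exact ⟨r.symm ⟨k, hk⟩, by simp⟩
  refine ⟨w, ?_, ?_⟩
  · intro S
    have key : ∀ k, k ≤ n → g ∅ + ∑ i ∈ S ∩ P k, w i ≤ g (S ∩ P k) := by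
      intro k
      induction k with
      | zero => intro _; simp [hP0]
      | succ k ih =>
        intro hk
        have ih := ih (by omega)
        obtain ⟨j, rfl⟩ := hex k (by omega)
        by_cases hj : j ∈ S
        · have e1 : S ∩ P (r j + 1) = insert j (S ∩ P (r j)) := by
            rw [hPs, Finset.inter_insert_of_mem hj]
          have hn : j ∉ S ∩ P (r j) := fun h => hjP j (Finset.mem_inter.1 h).2
          have hs := hsub (S ∩ P (r j + 1)) (P (r j))
          have e2 : S ∩ P (r j + 1) ∩ P (r j) = S ∩ P (r j) := by
            rw [hPs]; ext i; simp; tauto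
          have e3 : S ∩ P (r j + 1) ∪ P (r j) = P (r j + 1) := by
            rw [hPs]; ext i; simp only [Finset.mem_union, Finset.mem_inter, Finset.mem_insert]
            constructor
            · tauto
            · rintro (rfl | h)
              · exact Or.inl ⟨hj, Or.inl rfl⟩
              · exact Or.inr h
          rw [e2, e3] at hs
          have e4 : ∑ i ∈ S ∩ P (r j + 1), w i = w j + ∑ i ∈ S ∩ P (r j), w i := by
            rw [e1, Finset.sum_insert hn]
          rw [e4]
          simp only [w] at ih ⊢
          linarith
        · have e1 : S ∩ P (r j + 1) = S ∩ P (r j) := by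
            rw [hPs, Finset.inter_insert_of_notMem hj]
          rw [e1]; exact ih
    simpa [hPn] using key n le_rfl
  · intro τ
    set L : Finset (Fin n) := Finset.univ.filter fun i => τ < x i with hL
    have hlow : ∀ i j, r i ≤ r j → j ∈ L → i ∈ L := by
      intro i j h hj
      simp only [hL, Finset.mem_filter, Finset.mem_univ, true_and] at hj ⊢
      exact lt_of_lt_of_le hj (hr i j h)
    have key : ∀ k, k ≤ n → g (L ∩ P k) = g ∅ + ∑ i ∈ L ∩ P k, w i := by
      intro k
      induction k with
      | zero => intro _; simp [hP0]
      | succ k ih =>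
        intro hk
        have ih := ih (by omega)
        obtain ⟨j, rfl⟩ := hex k (by omega)
        by_cases hj : j ∈ L
        · have e0 : L ∩ P (r j) = P (r j) := by
            apply Finset.inter_eq_right.2
            intro i hi
            simp only [P, Finset.mem_filter, Finset.mem_univ, true_and] at hi
            exact hlow i j (le_of_lt hi) hj
          have e1 : L ∩ P (r j + 1) = insert j (P (r j)) := by
            rw [hPs, Finset.inter_insert_of_mem hj, e0]
          rw [e1, Finset.sum_insert (hjP j)]
          rw [e0] at ih
          have : w j = g (insert j (P (r j))) - g (P (r j)) := by simp only [w, hPs]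
          linarith
        · have e1 : L ∩ P (r j + 1) = L ∩ P (r j) := by
            rw [hPs, Finset.inter_insert_of_notMem hj]
          rw [e1]; exact ih
    simpa [hPn] using key n le_rfl

lemma step_integral (c a : ℝ) (h0 : 0 ≤ a) (h1 : a ≤ 1) :
    IntervalIntegrable (fun τ : ℝ => if τ < a then c else 0) volume 0 1 ∧
    ∫ τ in (0:ℝ)..1, (if τ < a then c else 0) = c * a := by
  have e : (fun τ : ℝ => if τ < a then c else 0) = (Set.Iio a).indicator (fun _ => c) := by
    ext τ; simp [Set.indicator_apply]
  constructor
  · rw [e, intervalIntegrable_iff]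
    exact (intervalIntegrable_iff.1 intervalIntegrable_const).indicator measurableSet_Iio
  · have hi : ∀ u v : ℝ, IntervalIntegrable (fun τ : ℝ => if τ < a then c else 0) volume u v := by
      intro u v
      rw [e, intervalIntegrable_iff]
      exact (intervalIntegrable_iff.1 intervalIntegrable_const).indicator measurableSet_Iio
    rw [← intervalIntegral.integral_add_adjacent_intervals (hi 0 a) (hi a 1),
      intervalIntegral.integral_congr_Ioo_of_le (g := fun _ => c) h0,
      intervalIntegral.integral_congr_Ioo_of_le (g := fun _ => 0) h1]
    · simp [mul_comm]
    · intro τ hτ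
      simp [not_lt.2 hτ.1.le]
    · intro τ hτ
      simp [hτ.2]

lemma lovasz_le_mix {n : ℕ} {α : Type*} (f : Finset (Fin n) → α → ℝ) (y : α)
    (hsub : ∀ S T : Finset (Fin n), f (S ∩ T) y + f (S ∪ T) y ≤ f S y + f T y)
    (p : Finset (Fin n) → ℝ) (hp : p ∈ stdSimplex ℝ (Finset (Fin n))) :
    lovasz f (fun i => ∑ S, if i ∈ S then p S else 0) y ≤ ∑ S, p S * f S y := by
  set x : Fin n → ℝ := fun i => ∑ S, if i ∈ S then p S else 0 with hx
  have hx0 : ∀ i, 0 ≤ x i := fun i => Finset.sum_nonneg fun S _ => by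
    split_ifs
    · exact hp.1 S
    · exact le_rfl
  have hx1 : ∀ i, x i ≤ 1 := fun i => by
    rw [← hp.2]
    refine Finset.sum_le_sum fun S _ => ?_
    split_ifs
    · exact le_rfl
    · exact hp.1 S
  obtain ⟨w, hw1, hw2⟩ := greedy_aux (fun S => f S y) hsub x
  have e1 : lovasz f x y = f ∅ y + ∑ i, w i * x i := by
    unfold lovasz
    simp only [hw2, Finset.sum_filter]
    rw [intervalIntegral.integral_add intervalIntegrable_const,
      intervalIntegral.integral_finsetSum]
    · simp [(step_integral _ _ (hx0 _) (hx1 _)).2]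
    · intro i _
      exact (step_integral _ _ (hx0 _) (hx1 _)).1
    · have := IntervalIntegrable.sum (μ := volume) (a := 0) (b := 1) Finset.univ
        (f := fun i => fun τ : ℝ => if τ < x i then w i else 0)
        (fun i _ => (step_integral _ _ (hx0 i) (hx1 i)).1)
      have e : (∑ i, fun τ : ℝ => if τ < x i then w i else 0)
          = fun τ : ℝ => ∑ i, if τ < x i then w i else 0 := by
        ext τ; simp
      rw [e] at this
      exact this
  have e2 : ∑ i, w i * x i = ∑ S, p S * ∑ i ∈ S, w i := by
    simp only [hx, Finset.mul_sum]
    rw [Finset.sum_comm]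
    refine Finset.sum_congr rfl fun S _ => ?_
    rw [← Finset.sum_filter_add_sum_filter_not Finset.univ (fun i => i ∈ S)]
    have : ∑ i with ¬ i ∈ S, w i * (if i ∈ S then p S else 0) = 0 :=
      Finset.sum_eq_zero fun i hi => by simp at hi; simp [hi]
    rw [this, add_zero, Finset.filter_univ_mem]
    refine Finset.sum_congr rfl fun i hi => ?_
    simp [hi, mul_comm]
  rw [e1, e2]
  calc f ∅ y + ∑ S, p S * ∑ i ∈ S, w i = ∑ S, p S * (f ∅ y + ∑ i ∈ S, w i) := by
        simp only [mul_add, Finset.sum_add_distrib]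
        rw [← Finset.sum_mul, hp.2, one_mul]
    _ ≤ _ := Finset.sum_le_sum fun S _ => mul_le_mul_of_nonneg_left (hw1 S) (hp.1 S)

lemma lovasz_vertex {n : ℕ} {α : Type*} (f : Finset (Fin n) → α → ℝ) (y : α)
    (x : Fin n → ℝ) (hx : x ∈ vertices n) :
    lovasz f x y = f (Finset.univ.filter fun i => x i = 1) y := by
  unfold lovasz
  rw [intervalIntegral.integral_congr_Ioo_of_le zero_le_one
    (g := fun _ => f (Finset.univ.filter fun i => x i = 1) y)]
  · simp
  · intro τ hτ
    have : (Finset.univ.filter fun i => τ < x i) = (Finset.univ.filter fun i => x i = 1) := by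
      ext i
      rcases hx i with h | h <;> simp [h] <;> linarith [hτ.1, hτ.2]
    simp only [this]

/-- Suppose `f : 2^{[n]} × ℝ^m → ℝ` is submodular in its first variable and concave
in its second variable, `f^L` is its Lovász extension in the first variable, and
`Y ⊂ ℝ^m` is nonempty, convex and compact. If
`min_{x∈[0,1]^n} max_{y∈Y} f^L(x,y) = min_{x∈{0,1}^n} max_{y∈Y} f^L(x,y)`, then
`max_{y∈Y} min_{S⊆[n]} f(S,y) = min_{S⊆[n]} max_{y∈Y} f(S,y)`, a saddle point of
`f` over `2^{[n]} × Y` exists, and the common value equals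
`min_{x∈[0,1]^n} max_{y∈Y} f^L(x,y)`. -/
theorem saddle_of_vertex_minmax (n m : ℕ)
    (f : Finset (Fin n) → EuclideanSpace ℝ (Fin m) → ℝ)
    (hsub : ∀ y, ∀ S T : Finset (Fin n), f (S ∩ T) y + f (S ∪ T) y ≤ f S y + f T y)
    (hconc : ∀ S : Finset (Fin n), ConcaveOn ℝ Set.univ (f S))
    (Y : Set (EuclideanSpace ℝ (Fin m))) (hY : Y.Nonempty)
    (hYconv : Convex ℝ Y) (hYc : IsCompact Y)
    (hver : sInf ((fun x => sSup ((fun y => lovasz f x y) '' Y)) '' Set.Icc (0 : Fin n → ℝ) 1)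
        = sInf ((fun x => sSup ((fun y => lovasz f x y) '' Y)) '' vertices n)) :
    (sSup ((fun y => (Finset.univ : Finset (Finset (Fin n))).inf'
            Finset.univ_nonempty (fun S => f S y)) '' Y)
        = (Finset.univ : Finset (Finset (Fin n))).inf'
            Finset.univ_nonempty (fun S => sSup ((fun y => f S y) '' Y)))
    ∧ (∃ Ss : Finset (Fin n), ∃ ys ∈ Y, ∀ S : Finset (Fin n), ∀ y ∈ Y,
        f Ss y ≤ f Ss ys ∧ f Ss ys ≤ f S ys)
    ∧ (Finset.univ : Finset (Finset (Fin n))).inf'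
            Finset.univ_nonempty (fun S => sSup ((fun y => f S y) '' Y))
        = sInf ((fun x => sSup ((fun y => lovasz f x y) '' Y)) '' Set.Icc (0 : Fin n → ℝ) 1) := by
  classical
  have hcont : ∀ S, Continuous (f S) := fun S => (hconc S).locallyLipschitz.continuous
  -- uniform bound
  obtain ⟨C, hC⟩ : ∃ C, ∀ S, ∀ y ∈ Y, |f S y| ≤ C := by
    have h1 : ∀ S, ∃ C, ∀ y ∈ Y, |f S y| ≤ C := fun S => by
      simpa using hYc.exists_bound_of_continuousOn (hcont S).continuousOn
    choose c hc using h1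
    refine ⟨(Finset.univ : Finset (Finset (Fin n))).sup' Finset.univ_nonempty c,
      fun S y hy => (hc S y hy).trans (Finset.le_sup' c (Finset.mem_univ S))⟩
  have hL : ∀ x, ∀ y ∈ Y, |lovasz f x y| ≤ C := by
    intro x y hy
    have := intervalIntegral.norm_integral_le_of_norm_le_const (a := (0:ℝ)) (b := 1) (C := C)
      (f := fun τ => f (Finset.univ.filter fun i => τ < x i) y) (fun τ _ => hC _ y hy)
    simpa [lovasz] using this
  obtain ⟨y0, hy0⟩ := hY
  have hbaL : ∀ x, BddAbove ((fun y => lovasz f x y) '' Y) := by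
    rintro x
    refine ⟨C, ?_⟩
    rintro _ ⟨y, hy, rfl⟩
    exact (abs_le.1 (hL x y hy)).2
  have hbaF : ∀ S, BddAbove ((fun y => f S y) '' Y) := by
    rintro x
    refine ⟨C, ?_⟩
    rintro _ ⟨y, hy, rfl⟩
    exact (abs_le.1 (hC x y hy)).2
  have hbb : ∀ A : Set (Fin n → ℝ),
      BddBelow ((fun x => sSup ((fun y => lovasz f x y) '' Y)) '' A) := by
    intro A
    refine ⟨-C, ?_⟩
    rintro _ ⟨x, _, rfl⟩
    exact (abs_le.1 (hL x y0 hy0)).1.trans (le_csSup (hbaL x) ⟨y0, hy0, rfl⟩)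
  -- value on vertices
  have hW : sInf ((fun x => sSup ((fun y => lovasz f x y) '' Y)) '' vertices n)
      = (Finset.univ : Finset (Finset (Fin n))).inf'
            Finset.univ_nonempty (fun S => sSup ((fun y => f S y) '' Y)) := by
    apply le_antisymm
    · apply Finset.le_inf'
      intro S _
      have hv : (fun i => if i ∈ S then (1:ℝ) else 0) ∈ vertices n := by
        intro i
        by_cases h : i ∈ S <;> simp [h]
      refine csInf_le (hbb _) ⟨_, hv, ?_⟩
      simp only [lovasz_vertex f _ _ hv]
      simp
    · apply le_csInf
      · exact ⟨_, ⟨fun _ => 0, fun i => Or.inl rfl, rfl⟩⟩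
      · rintro _ ⟨x, hx, rfl⟩
        simp only [lovasz_vertex f _ _ hx]
        exact Finset.inf'_le (fun S => sSup ((fun y => f S y) '' Y)) (Finset.mem_univ _)
  rw [hW] at hver
  -- minimax over mixed strategies
  obtain ⟨p, hp, ys, hys, hsad⟩ : ∃ p ∈ stdSimplex ℝ (Finset (Fin n)), ∃ ys ∈ Y,
      IsSaddlePointOn (stdSimplex ℝ (Finset (Fin n))) Y (fun p y => ∑ S, p S * f S y) p ys := by
    apply Sion.exists_isSaddlePointOn
    · exact ⟨_, single_mem_stdSimplex ℝ ∅⟩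
    · exact convex_stdSimplex ℝ _
    · exact isCompact_stdSimplex ℝ _
    · intro y _
      exact ContinuousOn.lowerSemicontinuousOn (by fun_prop)
    · intro y _
      apply ConvexOn.quasiconvexOn
      refine ⟨convex_stdSimplex ℝ _, fun a _ b _ s t _ _ _ => le_of_eq ?_⟩
      simp only [Pi.add_apply, Pi.smul_apply, smul_eq_mul, Finset.mul_sum]
      rw [← Finset.sum_add_distrib]
      exact Finset.sum_congr rfl fun S _ => by ring
    · exact hYconv
    · exact ⟨y0, hy0⟩
    · exact hYc
    · intro q _
      exact ContinuousOn.upperSemicontinuousOn (by fun_prop)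
    · intro q hq
      apply ConcaveOn.quasiconcaveOn
      refine ⟨hYconv, fun a _ b _ s t hs ht hst => ?_⟩
      simp only [smul_eq_mul, Finset.mul_sum]
      rw [← Finset.sum_add_distrib]
      refine Finset.sum_le_sum fun S _ => ?_
      have h1 := (hconc S).2 (Set.mem_univ a) (Set.mem_univ b) hs ht hst
      have h2 := mul_le_mul_of_nonneg_left h1 (hq.1 S)
      simp only [smul_eq_mul] at h2
      linarith
  have hGle : ∀ S, sInf ((fun x => sSup ((fun y => lovasz f x y) '' Y)) ''
      Set.Icc (0 : Fin n → ℝ) 1) ≤ f S ys := by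
    intro S
    refine (csInf_le (hbb _) (Set.mem_image_of_mem _
      (x := fun i => ∑ S, if i ∈ S then p S else 0) (Set.mem_Icc.2 ⟨?_, ?_⟩))).trans ?_
    · intro i
      refine Finset.sum_nonneg fun S _ => ?_
      split_ifs
      · exact hp.1 S
      · exact le_rfl
    · intro i
      simp only [Pi.one_apply]
      rw [← hp.2]
      refine Finset.sum_le_sum fun S _ => ?_
      split_ifs
      · exact le_rfl
      · exact hp.1 S
    · apply csSup_le (Set.Nonempty.image _ ⟨y0, hy0⟩)
      rintro _ ⟨y, hy, rfl⟩
      refine (lovasz_le_mix f y (hsub y) p hp).trans ?_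
      have := hsad _ (single_mem_stdSimplex ℝ S) y hy
      simpa [Pi.single_apply] using this
  rw [hver] at hGle
  obtain ⟨Ss, -, hSs⟩ := Finset.exists_mem_eq_inf' (Finset.univ_nonempty)
    (fun S => sSup ((fun y => f S y) '' Y))
  have hle : ∀ y ∈ Y, f Ss y ≤ (Finset.univ : Finset (Finset (Fin n))).inf'
            Finset.univ_nonempty (fun S => sSup ((fun y => f S y) '' Y)) := by
    intro y hy
    rw [hSs]
    exact le_csSup (hbaF Ss) ⟨y, hy, rfl⟩
  have hub : ∀ y ∈ Y, (Finset.univ : Finset (Finset (Fin n))).inf'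
            Finset.univ_nonempty (fun S => f S y) ≤
      (Finset.univ : Finset (Finset (Fin n))).inf'
            Finset.univ_nonempty (fun S => sSup ((fun y => f S y) '' Y)) := fun y hy =>
    (Finset.inf'_le (fun S => f S y) (Finset.mem_univ Ss)).trans (hle y hy)
  refine ⟨le_antisymm ?_ ?_, ⟨Ss, ys, hys, fun S y hy => ⟨(hle y hy).trans (hGle Ss),
    (hle ys hys).trans (hGle S)⟩⟩, hver.symm⟩
  · apply csSup_le (Set.Nonempty.image _ ⟨y0, hy0⟩)
    rintro _ ⟨y, hy, rfl⟩
    exact hub y hy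
  · refine le_trans (Finset.le_inf' _ _ fun S _ => hGle S) (le_csSup ⟨(Finset.univ :
      Finset (Finset (Fin n))).inf' Finset.univ_nonempty
        (fun S => sSup ((fun y => f S y) '' Y)), ?_⟩ ⟨ys, hys, rfl⟩)
    rintro _ ⟨y, hy, rfl⟩
    exact hub y hy
end

section
/- Let f : 2^{[n]} × ℝ^m → ℝ be submodular with respect to its first variable and concave with respect to its second variable, let f^L(x,y) = ∫₀¹ f(S_τ(x), y) dτ be its Lovász extension in the first variable, and let Y ⊂ ℝ^m be a nonempty convex compact set. If the family {f^L(·, y) : y ∈ Y} has a common vertex minimiser, i.e., there exists v ∈ {0,1}^n such that f^L(v, y) = min_{x ∈ [0,1]^n} f^L(x, y) for every y ∈ Y, then max_{y ∈ Y} min_{S ⊆ [n]} f(S,y) = min_{S ⊆ [n]} max_{y ∈ Y} f(S,y), so a saddle point of f exists. -/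
open MeasureTheory Finset

theorem lovasz_eq_aux {n : ℕ} {α : Type*} (f : Finset (Fin n) → α → ℝ)
    (x : Fin n → ℝ) (y : α) (S : Finset (Fin n))
    (h : ∀ τ : ℝ, 0 < τ → τ < 1 → (Finset.univ.filter fun i => τ < x i) = S) :
    lovasz f x y = f S y := by
  unfold lovasz
  have : ∫ τ in (0:ℝ)..1, f (Finset.univ.filter fun i => τ < x i) y
      = ∫ τ in (0:ℝ)..1, f S y := by
    apply intervalIntegral.integral_congr_ae
    have h1 : ∀ᵐ τ : ℝ, τ ≠ 1 := by
      simp [ae_iff]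
    filter_upwards [h1] with τ hτ hm
    rw [Set.uIoc_of_le zero_le_one] at hm
    rw [h τ hm.1 (lt_of_le_of_ne hm.2 hτ)]
  rw [this]
  simp

theorem lovasz_bdd_aux {n : ℕ} {α : Type*} (f : Finset (Fin n) → α → ℝ) (y : α)
    (s : Set (Fin n → ℝ)) : BddBelow ((fun x => lovasz f x y) '' s) := by
  refine ⟨-(∑ S : Finset (Fin n), |f S y|), ?_⟩
  rintro _ ⟨x, -, rfl⟩
  have := intervalIntegral.norm_integral_le_of_norm_le_const (a := (0:ℝ)) (b := 1)
    (f := fun τ => f (Finset.univ.filter fun i => τ < x i) y)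
    (C := ∑ S : Finset (Fin n), |f S y|) (fun τ _ =>
      Finset.single_le_sum (f := fun S => |f S y|) (fun _ _ => abs_nonneg _) (Finset.mem_univ _))
  simp only [sub_zero, abs_one, mul_one, Real.norm_eq_abs] at this
  exact neg_le_of_abs_le this

/-- Suppose `f : 2^{[n]} × ℝ^m → ℝ` is submodular in its first variable and concave
in its second variable, `f^L` is its Lovász extension in the first variable, and
`Y ⊂ ℝ^m` is nonempty, convex and compact. If the family `{f^L(·,y) : y ∈ Y}` has
a common vertex minimiser `v ∈ {0,1}^n`, then
`max_{y∈Y} min_{S⊆[n]} f(S,y) = min_{S⊆[n]} max_{y∈Y} f(S,y)` and a saddle point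
of `f` exists. -/
theorem saddle_of_common_vertex_minimiser (n m : ℕ)
    (f : Finset (Fin n) → EuclideanSpace ℝ (Fin m) → ℝ)
    (hsub : ∀ y, ∀ S T : Finset (Fin n), f (S ∩ T) y + f (S ∪ T) y ≤ f S y + f T y)
    (hconc : ∀ S : Finset (Fin n), ConcaveOn ℝ Set.univ (f S))
    (Y : Set (EuclideanSpace ℝ (Fin m))) (hY : Y.Nonempty)
    (hYconv : Convex ℝ Y) (hYc : IsCompact Y)
    (hcommon : ∃ v ∈ vertices n, ∀ y ∈ Y,
        lovasz f v y = sInf ((fun x => lovasz f x y) '' Set.Icc (0 : Fin n → ℝ) 1)) :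
    (sSup ((fun y => (Finset.univ : Finset (Finset (Fin n))).inf'
            Finset.univ_nonempty (fun S => f S y)) '' Y)
        = (Finset.univ : Finset (Finset (Fin n))).inf'
            Finset.univ_nonempty (fun S => sSup ((fun y => f S y) '' Y)))
    ∧ (∃ Ss : Finset (Fin n), ∃ ys ∈ Y, ∀ S : Finset (Fin n), ∀ y ∈ Y,
        f Ss y ≤ f Ss ys ∧ f Ss ys ≤ f S ys) := by
  obtain ⟨v, hv, hmin⟩ := hcommon
  have key : ∀ S : Finset (Fin n), ∀ y ∈ Y,
      f (Finset.univ.filter fun i => v i = 1) y ≤ f S y := by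
    intro S y hy
    rw [← lovasz_eq_aux f v y (Finset.univ.filter fun i => v i = 1), hmin y hy]
    · rw [← lovasz_eq_aux f (fun i => if i ∈ S then 1 else 0) y S]
      · apply csInf_le (lovasz_bdd_aux f y _)
        refine ⟨_, ⟨fun i => ?_, fun i => ?_⟩, rfl⟩ <;> by_cases h : i ∈ S <;> simp [h]
      · intro τ h0 h1
        ext i
        by_cases h : i ∈ S <;> simp [h, h1, h0.le]
    · intro τ h0 h1
      ext i
      rcases hv i with h | h <;> simp [h, h1, h0.le]
  generalize (Finset.univ.filter fun i => v i = 1) = S0 at key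
  have hcont : ∀ S, ContinuousOn (f S) Y := fun S =>
    ((hconc S).continuousOn isOpen_univ).mono (Set.subset_univ _)
  have hb : ∀ S, BddAbove ((fun y => f S y) '' Y) := fun S => hYc.bddAbove_image (hcont S)
  obtain ⟨ys, hys, hmax⟩ := hYc.exists_isMaxOn hY (hcont S0)
  refine ⟨?_, S0, ys, hys, fun S y hy => ⟨hmax hy, key S ys hys⟩⟩
  have e1 : (fun y => (Finset.univ : Finset (Finset (Fin n))).inf'
      Finset.univ_nonempty (fun S => f S y)) '' Y = (fun y => f S0 y) '' Y := by
    apply Set.image_congr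
    intro y hy
    exact le_antisymm (Finset.inf'_le _ (Finset.mem_univ S0))
      (Finset.le_inf' _ _ fun S _ => key S y hy)
  rw [e1]
  apply le_antisymm
  · refine Finset.le_inf' _ _ fun S _ => csSup_le (hY.image _) ?_
    rintro _ ⟨y, hy, rfl⟩
    exact (key S y hy).trans (le_csSup (hb S) ⟨y, hy, rfl⟩)
  · exact Finset.inf'_le _ (Finset.mem_univ S0)
end

section
/- Let Y ⊂ ℝ^m be a nonempty convex compact set and F : [0,1]^n × ℝ^m → ℝ be such that F(·, y) is convex on [0,1]^n for each y ∈ ℝ^m and F(x, ·) is concave and L-Lipschitz on ℝ^m for each x ∈ [0,1]^n, with L > 0. Let (x*, y*) ∈ [0,1]^n × Y be a saddle point of F on [0,1]^n × Y, and for μ > 0 let F_μ(x, y) = E_{u∼N(0,I_m)}[F(x, y + μu)] denote the Gaussian smoothing of F in y. Then for every (x, y) ∈ [0,1]^n × Y and every subgradient g_x of F(·, y) at x, one has F(x, y*) − F(x*, y) ≤ ⟨g_x, x − x*⟩ − ⟨∇_y F_μ(x, y), y − y*⟩ + μ L m^{1/2}. -/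
open MeasureTheory RealInnerProductSpace

/-- The standard Gaussian measure `N(0, I_m)` on `ℝ^m`, with density
`(2π)^{−m/2} e^{−‖u‖²/2}` with respect to the Lebesgue measure. -/
noncomputable def stdGaussian (m : ℕ) : Measure (EuclideanSpace ℝ (Fin m)) :=
  volume.withDensity fun u =>
    ENNReal.ofReal ((2 * Real.pi) ^ (-(m : ℝ) / 2) * Real.exp (-‖u‖ ^ 2 / 2))

/-- The hypercube `[0,1]^n ⊂ ℝ^n`. -/
def hypercube (n : ℕ) : Set (EuclideanSpace ℝ (Fin n)) :=
  {x | ∀ i, x i ∈ Set.Icc (0 : ℝ) 1}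

lemma sg_polar (m : ℕ) (hm : 0 < m) (f : ℝ → ℝ) :
    ∫ x : EuclideanSpace ℝ (Fin m), f ‖x‖ = m * (volume.real (Metric.ball (0 : EuclideanSpace ℝ (Fin m)) 1) *
      ∫ y in Set.Ioi (0 : ℝ), y ^ (m - 1) * f y) := by
  haveI : Nonempty (Fin m) := ⟨⟨0, hm⟩⟩
  have := integral_fun_norm_addHaar (volume : Measure (EuclideanSpace ℝ (Fin m))) f
  simpa using this

lemma sg_int0 (m : ℕ) : ∫ x : EuclideanSpace ℝ (Fin m), Real.exp (-‖x‖ ^ 2 / 2)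
    = (2 * Real.pi) ^ ((m : ℝ) / 2) := by
  have := GaussianFourier.integral_rexp_neg_mul_sq_norm (V := EuclideanSpace ℝ (Fin m))
    (b := 1 / 2) (by norm_num)
  rw [finrank_euclideanSpace_fin] at this
  convert this using 2
  · ext x; congr 1; ring
  · ring

lemma sg_int2 (m : ℕ) (hm : 0 < m) :
    ∫ x : EuclideanSpace ℝ (Fin m), ‖x‖ ^ 2 * Real.exp (-‖x‖ ^ 2 / 2)
    = m * (2 * Real.pi) ^ ((m : ℝ) / 2) := by
  have hm' : (0 : ℝ) < m := by exact_mod_cast hm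
  have key : ∫ y in Set.Ioi (0 : ℝ), y ^ (m - 1) * (y ^ 2 * Real.exp (-y ^ 2 / 2))
      = m * ∫ y in Set.Ioi (0 : ℝ), y ^ (m - 1) * Real.exp (-y ^ 2 / 2) := by
    have h1 := integral_rpow_mul_exp_neg_mul_rpow (p := 2) (q := (m : ℝ) - 1) (b := 1 / 2)
      (by norm_num) (by linarith) (by norm_num)
    have h2 := integral_rpow_mul_exp_neg_mul_rpow (p := 2) (q := (m : ℝ) + 1) (b := 1 / 2)
      (by norm_num) (by linarith) (by norm_num)
    have e1 : ∫ y in Set.Ioi (0 : ℝ), y ^ (m - 1) * Real.exp (-y ^ 2 / 2)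
        = ∫ x in Set.Ioi (0 : ℝ), x ^ ((m : ℝ) - 1) * Real.exp (-(1 / 2) * x ^ (2 : ℝ)) := by
      refine setIntegral_congr_fun measurableSet_Ioi (fun x hx => ?_)
      have : ((m : ℝ) - 1) = ((m - 1 : ℕ) : ℝ) := by
        rw [Nat.cast_sub hm]; simp
      simp only [this, Real.rpow_natCast, Real.rpow_two]
      congr 2; ring
    have e2 : ∫ y in Set.Ioi (0 : ℝ), y ^ (m - 1) * (y ^ 2 * Real.exp (-y ^ 2 / 2))
        = ∫ x in Set.Ioi (0 : ℝ), x ^ ((m : ℝ) + 1) * Real.exp (-(1 / 2) * x ^ (2 : ℝ)) := by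
      refine setIntegral_congr_fun measurableSet_Ioi (fun x hx => ?_)
      have : ((m : ℝ) + 1) = ((m - 1 + 2 : ℕ) : ℝ) := by
        have : m - 1 + 2 = m + 1 := by omega
        rw [this]; simp
      simp only [this, Real.rpow_natCast, Real.rpow_two]
      rw [pow_add, mul_assoc]
      congr 3; ring
    rw [e1, e2, h1, h2]
    have a1 : ((m : ℝ) + 1 + 1) / 2 = (m : ℝ) / 2 + 1 := by ring
    have a2 : ((m : ℝ) - 1 + 1) / 2 = (m : ℝ) / 2 := by ring
    have a3 : -((m : ℝ) + 1 + 1) / 2 = -((m : ℝ) - 1 + 1) / 2 + (-1) := by ring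
    rw [a1, a2, a3, Real.Gamma_add_one (by positivity), Real.rpow_add (by norm_num),
      Real.rpow_neg_one]
    norm_num
    ring
  have p0 := sg_polar m hm (fun r => Real.exp (-r ^ 2 / 2))
  have p2 := sg_polar m hm (fun r => r ^ 2 * Real.exp (-r ^ 2 / 2))
  rw [p2, key, ← sg_int0, p0]
  ring

lemma sg_meas (m : ℕ) : Measurable fun u : EuclideanSpace ℝ (Fin m) =>
    ENNReal.ofReal ((2 * Real.pi) ^ (-(m : ℝ) / 2) * Real.exp (-‖u‖ ^ 2 / 2)) := by
  fun_prop

lemma sg_integral (m : ℕ) (g : EuclideanSpace ℝ (Fin m) → ℝ) :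
    ∫ u, g u ∂(stdGaussian m) = ∫ u, (2 * Real.pi) ^ (-(m : ℝ) / 2) *
      (g u * Real.exp (-‖u‖ ^ 2 / 2)) := by
  unfold stdGaussian
  rw [integral_withDensity_eq_integral_toReal_smul (sg_meas m) (by simp)]
  congr 1; ext u
  rw [ENNReal.toReal_ofReal (by positivity), smul_eq_mul]; ring

lemma sg_const (m : ℕ) : (2 * Real.pi) ^ (-(m : ℝ) / 2) * (2 * Real.pi) ^ ((m : ℝ) / 2) = 1 := by
  rw [← Real.rpow_add (by positivity)]
  rw [show -(m : ℝ) / 2 + (m : ℝ) / 2 = 0 by ring, Real.rpow_zero]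

lemma sg_one (m : ℕ) : ∫ _u, (1 : ℝ) ∂(stdGaussian m) = 1 := by
  rw [sg_integral, integral_const_mul]
  simp only [one_mul]
  rw [sg_int0, sg_const]

lemma sg_prob (m : ℕ) : IsProbabilityMeasure (stdGaussian m) := by
  have h := sg_one m
  simp only [integral_const, smul_eq_mul, mul_one] at h
  constructor
  rw [measureReal_def] at h
  have := (ENNReal.toReal_eq_one_iff _).1 h
  exact this

lemma sg_sq (m : ℕ) : ∫ u, ‖u‖ ^ 2 ∂(stdGaussian m) = m := by
  rcases Nat.eq_zero_or_pos m with rfl | hm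
  · have : ∀ u : EuclideanSpace ℝ (Fin 0), ‖u‖ = 0 := fun u => by
      rw [Subsingleton.elim u 0, norm_zero]
    simp [this]
  rw [sg_integral, integral_const_mul, sg_int2 m hm, mul_left_comm, sg_const, mul_one]

lemma sg_sq_int (m : ℕ) : Integrable (fun u => ‖u‖ ^ 2) (stdGaussian m) := by
  rcases Nat.eq_zero_or_pos m with rfl | hm
  · have : ∀ u : EuclideanSpace ℝ (Fin 0), ‖u‖ = 0 := fun u => by
      rw [Subsingleton.elim u 0, norm_zero]
    simp [this]
  apply Integrable.of_integral_ne_zero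
  rw [sg_sq]
  exact_mod_cast hm.ne'

lemma sg_norm_int (m : ℕ) : Integrable (fun u => ‖u‖) (stdGaussian m) := by
  haveI := sg_prob m
  refine ((sg_sq_int m).add (integrable_const 1)).mono' (by fun_prop) (.of_forall fun u => ?_)
  simp only [norm_norm, Pi.add_apply]
  nlinarith [sq_nonneg (‖u‖ - 1), sq_nonneg ‖u‖]

lemma sg_norm_le (m : ℕ) : ∫ u, ‖u‖ ∂(stdGaussian m) ≤ Real.sqrt m := by
  haveI := sg_prob m
  rcases Nat.eq_zero_or_pos m with rfl | hm
  · have : ∀ u : EuclideanSpace ℝ (Fin 0), ‖u‖ = 0 := fun u => by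
      rw [Subsingleton.elim u 0, norm_zero]
    simp [this]
  have hs : 0 < Real.sqrt m := Real.sqrt_pos.2 (by exact_mod_cast hm)
  have hss : Real.sqrt m * Real.sqrt m = m := Real.mul_self_sqrt (by positivity)
  have h : ∫ u, (2 * Real.sqrt m) * ‖u‖ ∂(stdGaussian m) ≤ ∫ u, (‖u‖ ^ 2 + m) ∂(stdGaussian m) := by
    apply integral_mono ((sg_norm_int m).const_mul _) ((sg_sq_int m).add (integrable_const _))
    intro u
    simp only [Pi.add_apply, Pi.sub_apply]
    nlinarith [sq_nonneg (‖u‖ - Real.sqrt m)]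
  rw [integral_const_mul, integral_add (sg_sq_int m) (integrable_const _), sg_sq] at h
  simp only [integral_const, probReal_univ, one_smul] at h
  nlinarith

lemma sg_neg (m : ℕ) (g : EuclideanSpace ℝ (Fin m) → ℝ) :
    ∫ u, g (-u) ∂(stdGaussian m) = ∫ u, g u ∂(stdGaussian m) := by
  rw [sg_integral, sg_integral, ← integral_neg_eq_self (fun u => (2 * Real.pi) ^ (-(m : ℝ) / 2) *
      (g u * Real.exp (-‖u‖ ^ 2 / 2)))]
  simp only [norm_neg]

lemma sg_core (m : ℕ) (f : EuclideanSpace ℝ (Fin m) → ℝ) (L μ : ℝ) (hL : 0 < L) (hμ : 0 < μ)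
    (hf : ConcaveOn ℝ Set.univ f) (hl : ∀ y y', |f y - f y'| ≤ L * ‖y - y'‖)
    (g y z : EuclideanSpace ℝ (Fin m))
    (hg : HasGradientAt (fun y' => ∫ u, f (y' + μ • u) ∂(stdGaussian m)) g y) :
    f z - f y ≤ - ⟪g, y - z⟫ + μ * L * Real.sqrt m := by
  haveI := sg_prob m
  set G : EuclideanSpace ℝ (Fin m) → ℝ := fun y' => ∫ u, f (y' + μ • u) ∂(stdGaussian m) with hG
  have hcont : Continuous f := by
    have : LipschitzWith ⟨L, hL.le⟩ f := LipschitzWith.of_dist_le_mul fun a b => by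
      rw [Real.dist_eq, dist_eq_norm]; exact hl a b
    exact this.continuous
  have hb : ∀ w u : EuclideanSpace ℝ (Fin m), |f w - f (w + μ • u)| ≤ μ * L * ‖u‖ := fun w u => by
    have := hl w (w + μ • u)
    rw [sub_add_cancel_left, norm_neg, norm_smul, Real.norm_of_nonneg hμ.le] at this
    linarith
  have hi : ∀ w, Integrable (fun u => f (w + μ • u)) (stdGaussian m) := fun w => by
    refine ((integrable_const |f w|).add ((sg_norm_int m).const_mul (μ * L))).mono'
      (by fun_prop) (.of_forall fun u => ?_)
    have := hb w u
    simp only [Pi.add_apply, Real.norm_eq_abs]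
    have h2 := abs_sub_abs_le_abs_sub (f (w + μ • u)) (f w)
    rw [abs_sub_comm] at h2
    linarith
  have hlow : ∀ w, f w - μ * L * Real.sqrt m ≤ G w := fun w => by
    have h1 : ∫ u, (f w - μ * L * ‖u‖) ∂(stdGaussian m) ≤ G w := by
      apply integral_mono ((integrable_const _).sub ((sg_norm_int m).const_mul _)) (hi w)
      intro u
      have := (abs_le.1 (hb w u)).2
      simp only [Pi.add_apply, Pi.sub_apply]
      linarith
    rw [integral_sub (integrable_const _) ((sg_norm_int m).const_mul _), integral_const_mul] at h1
    simp only [integral_const, probReal_univ, one_smul] at h1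
    have := mul_le_mul_of_nonneg_left (sg_norm_le m) (mul_pos hμ hL).le
    linarith
  have hup : ∀ w, G w ≤ f w := fun w => by
    have hn := sg_neg m (fun u => f (w + μ • u))
    have hi' : Integrable (fun u => f (w + μ • (-u))) (stdGaussian m) := by
      refine ((integrable_const |f w|).add ((sg_norm_int m).const_mul (μ * L))).mono'
        (by fun_prop) (.of_forall fun u => ?_)
      have := hb w (-u)
      rw [norm_neg] at this
      simp only [Pi.add_apply, Real.norm_eq_abs]
      have h2 := abs_sub_abs_le_abs_sub (f (w + μ • (-u))) (f w)
      rw [abs_sub_comm] at h2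
      linarith
    have h1 : ∫ u, (f (w + μ • (-u)) + f (w + μ • u)) ∂(stdGaussian m)
        ≤ ∫ u, 2 * f w ∂(stdGaussian m) := by
      apply integral_mono (hi'.add (hi w)) (integrable_const _)
      intro u
      have := hf.2 (Set.mem_univ (w + μ • (-u))) (Set.mem_univ (w + μ • u))
        (show (0 : ℝ) ≤ 1 / 2 by norm_num) (show (0 : ℝ) ≤ 1 / 2 by norm_num) (by norm_num)
      rw [show (1 / 2 : ℝ) • (w + μ • (-u)) + (1 / 2 : ℝ) • (w + μ • u) = w by module] at this
      simp only [smul_eq_mul, Pi.add_apply] at this ⊢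
      linarith
    rw [integral_add hi' (hi w), hn] at h1
    simp only [integral_const, probReal_univ, one_smul] at h1
    simp only [hG]
    linarith
  have hGc : ConcaveOn ℝ Set.univ G := by
    refine ⟨convex_univ, fun a _ b _ s t hs ht hst => ?_⟩
    simp only [hG, smul_eq_mul]
    rw [← integral_const_mul, ← integral_const_mul,
      ← integral_add ((hi a).const_mul _) ((hi b).const_mul _)]
    apply integral_mono (((hi a).const_mul _).add ((hi b).const_mul _)) (hi _)
    intro u
    have := hf.2 (Set.mem_univ (a + μ • u)) (Set.mem_univ (b + μ • u)) hs ht hst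
    have e : s • (a + μ • u) + t • (b + μ • u) = s • a + t • b + μ • u := by
      have : s • (a + μ • u) + t • (b + μ • u) = s • a + t • b + (s + t) • μ • u := by module
      rw [this, hst, one_smul]
    rw [e] at this
    simpa using this
  have hgr : G z - G y ≤ ⟪g, z - y⟫ := by
    have hφ : ConcaveOn ℝ Set.univ (G ∘ (AffineMap.lineMap y z : ℝ →ᵃ[ℝ] _)) := by
      simpa using hGc.comp_affineMap (AffineMap.lineMap y z : ℝ →ᵃ[ℝ] _)
    have hd : HasDerivAt (G ∘ (AffineMap.lineMap y z : ℝ →ᵃ[ℝ] _)) ⟪g, z - y⟫ 0 := by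
      have h1 : HasDerivAt (AffineMap.lineMap y z : ℝ → EuclideanSpace ℝ (Fin m)) (z - y) 0 :=
        AffineMap.hasDerivAt_lineMap
      have h2 := hg.hasFDerivAt
      rw [← AffineMap.lineMap_apply_zero (k := ℝ) y z] at h2
      simpa using h2.comp_hasDerivAt (0 : ℝ) h1
    have := hφ.slope_le_of_hasDerivAt (Set.mem_univ 0) (Set.mem_univ 1) one_pos hd
    simpa [slope_def_field] using this
  have e : ⟪g, z - y⟫ = - ⟪g, y - z⟫ := by rw [← inner_neg_right, neg_sub]
  have := hlow z
  have := hup y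
  linarith

/-- Let `Y ⊂ ℝ^m` be nonempty, convex and compact, and let
`F : [0,1]^n × ℝ^m → ℝ` be convex in `x` on `[0,1]^n` and concave and
`L`-Lipschitz in `y` on `ℝ^m`, with `L > 0`. Let `(x*, y*)` be a saddle point of
`F` on `[0,1]^n × Y`, and for `μ > 0` let `F_μ(x,y) = E_{u∼N(0,I_m)}[F(x, y+μu)]`
be the Gaussian smoothing of `F` in `y`, with gradient `∇_y F_μ`. Then for every
`(x,y) ∈ [0,1]^n × Y` and every subgradient `g_x` of `F(·,y)` at `x`,
`F(x,y*) − F(x*,y) ≤ ⟨g_x, x − x*⟩ − ⟨∇_y F_μ(x,y), y − y*⟩ + μ L m^{1/2}`. -/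
theorem smoothed_restricted_gap_bound (n m : ℕ)
    (Y : Set (EuclideanSpace ℝ (Fin m))) (hY : Y.Nonempty)
    (hYconv : Convex ℝ Y) (hYc : IsCompact Y)
    (F : EuclideanSpace ℝ (Fin n) → EuclideanSpace ℝ (Fin m) → ℝ)
    (L : ℝ) (hL : 0 < L)
    (hcvx : ∀ y : EuclideanSpace ℝ (Fin m), ConvexOn ℝ (hypercube n) (fun x => F x y))
    (hconc : ∀ x ∈ hypercube n, ConcaveOn ℝ Set.univ (F x))
    (hlip : ∀ x ∈ hypercube n, ∀ y y' : EuclideanSpace ℝ (Fin m),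
      |F x y - F x y'| ≤ L * ‖y - y'‖)
    (μ : ℝ) (hμ : 0 < μ)
    (gradFμ : EuclideanSpace ℝ (Fin n) → EuclideanSpace ℝ (Fin m) →
      EuclideanSpace ℝ (Fin m))
    (hgrad : ∀ x ∈ hypercube n, ∀ y : EuclideanSpace ℝ (Fin m),
      HasGradientAt (fun y' => ∫ u, F x (y' + μ • u) ∂(stdGaussian m)) (gradFμ x y) y)
    (xstar : EuclideanSpace ℝ (Fin n)) (ystar : EuclideanSpace ℝ (Fin m))
    (hxs : xstar ∈ hypercube n) (hys : ystar ∈ Y)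
    (hsaddle : ∀ x ∈ hypercube n, ∀ y ∈ Y,
      F xstar y ≤ F xstar ystar ∧ F xstar ystar ≤ F x ystar) :
    ∀ x ∈ hypercube n, ∀ y ∈ Y, ∀ gx : EuclideanSpace ℝ (Fin n),
      (∀ x' ∈ hypercube n, F x y + ⟪gx, x' - x⟫ ≤ F x' y) →
      F x ystar - F xstar y
        ≤ ⟪gx, x - xstar⟫ - ⟪gradFμ x y, y - ystar⟫ + μ * L * Real.sqrt m := by
  intro x hx y hy gx hsub
  have h1 := sg_core m (F x) L μ hL hμ (hconc x hx) (hlip x hx) (gradFμ x y) y ystar (hgrad x hx y)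
  have h2 := hsub xstar hxs
  have e : ⟪gx, xstar - x⟫ = - ⟪gx, x - xstar⟫ := by rw [← inner_neg_right, neg_sub]
  linarith
end
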